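/- For n ≥ 2, the number T_{n,2} of maxmin trees on {1,…,n} (i.e., tiered trees with tiering functions valued in {1,2}) is given by T_{n,2} = (1/(n·2^{n−1})) · Σ_{k=1}^{n} (n choose k) · k^{n−1}. -/

import Mathlib

open scoped Classical

/-- Reachability along a finite edge set (edges are unordered pairs of naturals). -/
def EReach (E : Finset (Sym2 ℕ)) : ℕ → ℕ → Prop :=
  Relation.ReflTransGen fun a b => s(a, b) ∈ E

/-- `E` is the edge set of a tree on the vertex set `V`: all edges join distinct
vertices of `V`, any two vertices of `V` are joined by a walk, and the number of
edges is one less than the number of vertices. -/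
def IsTreeOn (V : Finset ℕ) (E : Finset (Sym2 ℕ)) : Prop :=
  (∀ e ∈ E, ∀ x ∈ e, x ∈ V) ∧ (∀ e ∈ E, ¬ e.IsDiag) ∧
    (∀ a ∈ V, ∀ b ∈ V, EReach E a b) ∧ E.card + 1 = V.card

/-- `t` is a tiering function (with tiers `1, …, m`) for the graph with vertex set `V`
and edge set `E`: tiers lie in `{1, …, m}` and if `a < b` are adjacent then `t a < t b`. -/
def IsTieredOn (V : Finset ℕ) (E : Finset (Sym2 ℕ)) (m : ℕ) (t : ℕ → ℕ) : Prop :=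
  (∀ v ∈ V, t v ∈ Finset.Icc 1 m) ∧ ∀ a b : ℕ, s(a, b) ∈ E → a < b → t a < t b

/-- Auxiliary fuelled recursion computing the weight of a tiered tree: delete the
minimal vertex `v`, and sum, over the components `C` of the resulting forest
(one for each neighbour `u` of `v`), the weight of the component plus the number
of vertices `x ∈ C` with `t x > t v` and `x < u`.  (Fuel `V.card` always suffices,
since components are strictly smaller.) -/
noncomputable def treeWeightAux (t : ℕ → ℕ) : ℕ → Finset ℕ → Finset (Sym2 ℕ) → ℕ
  | 0, _, _ => 0
  | fuel + 1, V, E =>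
    if h : 2 ≤ V.card then
      let v := V.min' (Finset.card_pos.mp (by omega))
      let E' := E.filter fun e => v ∉ e
      ((V.erase v).filter fun u => s(v, u) ∈ E).sum fun u =>
        let C := (V.erase v).filter fun x => EReach E' u x
        (C.filter fun x => t v < t x ∧ x < u).card +
          treeWeightAux t fuel C (E'.filter fun e => ∀ x ∈ e, x ∈ C)
    else 0

/-- The weight of a tiered tree with vertex set `V`, edge set `E` and tiering function `t`. -/
noncomputable def treeWeight (V : Finset ℕ) (E : Finset (Sym2 ℕ)) (t : ℕ → ℕ) : ℕ :=
  treeWeightAux t V.card V E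

/-- The set of tiered trees on `{1,…,n}` with tiering functions valued in `{1,…,m}`
(surjective or not), encoded as pairs `(E, t)` of an edge set and a tiering function,
normalised to vanish off `{1,…,n}`. -/
def TieredTrees (n m : ℕ) : Set (Finset (Sym2 ℕ) × (ℕ → ℕ)) :=
  {T | IsTreeOn (Finset.Icc 1 n) T.1 ∧ IsTieredOn (Finset.Icc 1 n) T.1 m T.2 ∧
    ∀ x, x ∉ Finset.Icc 1 n → T.2 x = 0}

/-- `T_{n,m}`: the number of tiered trees on `{1,…,n}` with tiers valued in `{1,…,m}`. -/
noncomputable def Tcount (n m : ℕ) : ℕ := Nat.card (TieredTrees n m)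

section Algebra

open PowerSeries

lemma PowerSeries.eq_zero_of_derivative_eq_mul {R : Type*} [CommRing R] [IsAddTorsionFree R]
    {c f : R⟦X⟧} (hf : derivative R f = c * f) (h0 : constantCoeff f = 0) : f = 0 := by
  ext n
  induction n using Nat.strong_induction_on with
  | _ n ih =>
    cases n with
    | zero => simpa using h0
    | succ n =>
      have h := congrArg (coeff n) hf
      rw [coeff_derivative, coeff_mul, Finset.sum_eq_zero] at h
      · have h' : (n + 1) • coeff (n + 1) f = 0 := by
          rw [nsmul_eq_mul, mul_comm]; exact_mod_cast h
        simpa using (smul_eq_zero_iff_right (Nat.succ_ne_zero n)).mp h'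
      · intro ij hij
        have := Finset.HasAntidiagonal.mem_antidiagonal.mp hij
        rw [ih ij.2 (by omega)]
        simp

/-- The polynomial `z * ∑ k, (n choose k) * (z + k) ^ (n - 1)`. -/
noncomputable def abelPoly (n : ℕ) : Polynomial ℚ :=
  Polynomial.X * ∑ k ∈ Finset.range (n + 1),
    (n.choose k : Polynomial ℚ) * (Polynomial.X + (k : Polynomial ℚ)) ^ (n - 1)

lemma abelPoly_derivative_one : Polynomial.derivative (abelPoly 1) = 2 := by
  simp [abelPoly, Finset.sum_range_succ]
  norm_num

lemma abelPoly_derivative (n : ℕ) :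
    Polynomial.derivative (abelPoly (n + 2)) = ((n + 2 : ℕ) : Polynomial ℚ) *
      (abelPoly (n + 1) + (abelPoly (n + 1)).comp (Polynomial.X + 1)) := by
  have hL : Polynomial.derivative (abelPoly (n + 2)) = ∑ k ∈ Finset.range (n + 3),
      (((n + 2).choose k : ℕ) : Polynomial ℚ) *
        (((n + 2 : ℕ) : Polynomial ℚ) * Polynomial.X + (k : Polynomial ℚ)) *
        (Polynomial.X + (k : Polynomial ℚ)) ^ n := by
    simp only [abelPoly, Polynomial.derivative_mul, Polynomial.derivative_X, one_mul,
      Polynomial.derivative_sum, Finset.mul_sum]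
    refine Finset.sum_congr rfl fun k _ => ?_
    simp only [Polynomial.derivative_natCast, Polynomial.derivative_pow, Polynomial.derivative_add,
      Polynomial.derivative_X, zero_mul, zero_add, add_zero, mul_one,
      show n + 2 - 1 = n + 1 by omega, show n + 1 - 1 = n by omega, map_natCast]
    push_cast
    ring
  have hA : abelPoly (n + 1) = ∑ k ∈ Finset.range (n + 3),
      (((n + 1).choose k : ℕ) : Polynomial ℚ) * Polynomial.X *
        (Polynomial.X + (k : Polynomial ℚ)) ^ n := by
    rw [Finset.sum_range_succ, Nat.choose_succ_self]
    simp only [abelPoly, Finset.mul_sum, Nat.add_sub_cancel, Nat.cast_zero, zero_mul, add_zero]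
    exact Finset.sum_congr rfl fun k _ => by ring
  have hB : (abelPoly (n + 1)).comp (Polynomial.X + 1) = ∑ k ∈ Finset.range (n + 2),
      (((n + 1).choose k : ℕ) : Polynomial ℚ) * (Polynomial.X + 1) *
        (Polynomial.X + ((k + 1 : ℕ) : Polynomial ℚ)) ^ n := by
    rw [← Polynomial.coe_compRingHom_apply, abelPoly, Finset.mul_sum, map_sum]
    simp only [Polynomial.coe_compRingHom_apply, Polynomial.mul_comp, Polynomial.X_comp,
      Polynomial.natCast_comp, Polynomial.pow_comp, Polynomial.add_comp, Nat.add_sub_cancel]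
    refine Finset.sum_congr rfl fun k _ => ?_
    push_cast
    ring
  rw [hL, hB, hA, Finset.sum_range_succ', Finset.sum_range_succ' _ (n + 2), add_right_comm,
    ← Finset.sum_add_distrib, mul_add ((n + 2 : ℕ) : Polynomial ℚ), Finset.mul_sum]
  congr 1
  · refine Finset.sum_congr rfl fun k _ => ?_
    have h1 : (((n + 2).choose (k + 1) : ℕ) : Polynomial ℚ)
        = ((n + 1).choose k : ℕ) + ((n + 1).choose (k + 1) : ℕ) := by
      rw [Nat.choose_succ_succ' (n + 1) k]; push_cast; rfl
    have h2 : ((n + 2 : ℕ) : Polynomial ℚ) * ((n + 1).choose k : ℕ)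
        = ((n + 2).choose (k + 1) : ℕ) * ((k + 1 : ℕ) : Polynomial ℚ) := by
      exact_mod_cast Nat.add_one_mul_choose_eq (n + 1) k
    rw [mul_add, ← h2, h1]
    ring
  · simp
    ring

lemma polynomial_eq_of_derivative_eq {p q : Polynomial ℚ}
    (hd : Polynomial.derivative p = Polynomial.derivative q) (h0 : p.eval 0 = q.eval 0) :
    p = q := by
  have h : Polynomial.derivative (p - q) = 0 := by simp [hd]
  have h' := Polynomial.eq_C_of_derivative_eq_zero h
  have h2 : (p - q).coeff 0 = 0 := by
    rw [Polynomial.coeff_zero_eq_eval_zero]; simp [h0]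
  rw [h2] at h'
  simpa [sub_eq_zero] using h'

/-- A sequence of polynomials with the derivative recursion of the Abel-type polynomials. -/
lemma eq_abelPoly_of_derivative {q : ℕ → Polynomial ℚ} (h0 : q 0 = 1)
    (hz : ∀ n, (q (n + 1)).eval 0 = 0)
    (hd : ∀ n, 2 * Polynomial.derivative (q (n + 1)) =
      q n + (q n).comp (Polynomial.X + 1)) (n : ℕ) :
    Polynomial.C (2 ^ (n + 1) * ((n + 1).factorial : ℚ)) * q (n + 1) = abelPoly (n + 1) := by
  induction n with
  | zero =>
    apply polynomial_eq_of_derivative_eq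
    · have := hd 0
      rw [h0] at this
      rw [abelPoly_derivative_one]
      simp at this ⊢
      rw [show (Polynomial.C 2 : Polynomial ℚ) = 2 from rfl, this]
      norm_num
    · simp [hz, abelPoly]
  | succ n ih =>
    apply polynomial_eq_of_derivative_eq
    · rw [abelPoly_derivative, ← ih, Polynomial.mul_comp, Polynomial.C_comp, ← mul_add, ← hd]
      rw [Polynomial.derivative_C_mul, Nat.factorial_succ (n + 1)]
      simp only [Nat.cast_mul, map_mul, map_pow, map_natCast]
      rw [show (Polynomial.C 2 : Polynomial ℚ) = 2 from rfl]
      ring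
    · simp [hz, abelPoly]

lemma PowerSeries.constantCoeff_map_apply {R S : Type*} [CommRing R] [CommRing S] (f : R →+* S)
    (g : R⟦X⟧) : constantCoeff (PowerSeries.map f g) = f (constantCoeff g) := by
  rw [← coeff_zero_eq_constantCoeff_apply, coeff_map, coeff_zero_eq_constantCoeff_apply]

lemma PowerSeries.derivative_mul' {R : Type*} [CommRing R] (f g : R⟦X⟧) :
    derivative R (f * g) = f * derivative R g + g * derivative R f := by
  simp [Derivation.leibniz]

lemma lagrange_step {y G : ℚ⟦X⟧} (hy0 : constantCoeff y = 0) (hG0 : constantCoeff G = 1)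
    (hG : derivative ℚ G = derivative ℚ y * G) (hy : 2 * y = X * (1 + G)) (n : ℕ) :
    2 ^ (n + 1) * ((n + 1).factorial : ℚ) * coeff (n + 1) y =
      ∑ k ∈ Finset.range (n + 2), ((n + 1).choose k : ℚ) * (k : ℚ) ^ n := by
  let ι : ℚ⟦X⟧ →+* (Polynomial ℚ)⟦X⟧ := PowerSeries.map Polynomial.C
  have hι (f : ℚ⟦X⟧) : derivative (Polynomial ℚ) (ι f) = ι (derivative ℚ f) := by
    ext1 n; simp [ι, coeff_derivative]
  let z : (Polynomial ℚ)⟦X⟧ := PowerSeries.C Polynomial.X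
  have hs : HasSubst (z * ι y) := by
    apply HasSubst.of_constantCoeff_zero'
    simp [ι, hy0, constantCoeff_map_apply]
  obtain ⟨Φ, hΦ, hΦ0⟩ : ∃ Φ : (Polynomial ℚ)⟦X⟧,
      derivative _ Φ = z * ι (derivative ℚ y) * Φ ∧ constantCoeff Φ = 1 := by
    refine ⟨(exp (Polynomial ℚ)).subst (z * ι y), ?_, ?_⟩
    · rw [derivative_subst hs, derivative_exp]
      rw [derivative_mul', hι]
      simp [z]
      ring
    · rw [← coeff_zero_eq_constantCoeff_apply, coeff_subst' hs, finsum_eq_single _ 0]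
      · simp
      · intro k hk
        simp [ι, hy0, hk, constantCoeff_map_apply]
  let D : (Polynomial ℚ)⟦X⟧ → (Polynomial ℚ)⟦X⟧ :=
    fun f => PowerSeries.mk fun n => Polynomial.derivative (coeff n f)
  have hDd (f) : derivative _ (D f) = D (derivative _ f) := by
    ext1 n
    simp only [coeff_derivative, D, coeff_mk, Polynomial.derivative_mul]
    simp
  have hDz (c : ℚ⟦X⟧) (f) : D (z * ι c * f) = ι c * f + z * ι c * D f := by
    ext1 n
    rw [mul_assoc, mul_assoc, map_add]
    simp only [D, z, ι, coeff_mk, coeff_C_mul, Polynomial.derivative_mul, Polynomial.derivative_X,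
      one_mul]
    congr 2
    simp [coeff_mul, Polynomial.derivative_mul]
  have hDΦ : D Φ = ι y * Φ := by
    rw [← sub_eq_zero]
    apply eq_zero_of_derivative_eq_mul (c := z * ι (derivative ℚ y))
    · rw [map_sub, hDd, hΦ, hDz, derivative_mul', hι, hΦ]
      ring
    · have : constantCoeff (D Φ) = Polynomial.derivative (constantCoeff Φ) := by
        rw [← coeff_zero_eq_constantCoeff_apply, coeff_mk, coeff_zero_eq_constantCoeff_apply]
      simp [ι, hy0, this, hΦ0, constantCoeff_map_apply]
  let σ : Polynomial ℚ →+* Polynomial ℚ := Polynomial.compRingHom (Polynomial.X + 1)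
  have hσd (f) : derivative _ (PowerSeries.map σ f) = PowerSeries.map σ (derivative _ f) := by
    ext1 n; simp [coeff_derivative, σ]
  have hσι (f : ℚ⟦X⟧) : PowerSeries.map σ (ι f) = ι f := by
    ext1 n; simp [ι, σ]
  have hσΦ : PowerSeries.map σ Φ = ι G * Φ := by
    rw [← sub_eq_zero]
    apply eq_zero_of_derivative_eq_mul (c := (z + 1) * ι (derivative ℚ y))
    · rw [map_sub, hσd, hΦ, map_mul, map_mul, hσι, derivative_mul', hι, hΦ, hG, map_mul]
      have : PowerSeries.map σ z = z + 1 := by simp [z, σ]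
      rw [this]
      ring
    · simp [ι, hΦ0, hG0, σ, constantCoeff_map_apply]
  have hkey : 2 * D Φ = X * (Φ + PowerSeries.map σ Φ) := by
    have h2 : 2 * ι y = X * (1 + ι G) := by
      have := congrArg ι hy
      rwa [map_mul, map_mul, map_add, map_one, map_ofNat, map_X] at this
    rw [hDΦ, hσΦ, ← mul_assoc, h2]
    ring
  have hev : PowerSeries.map (Polynomial.evalRingHom (0 : ℚ)) Φ = 1 := by
    apply derivative.ext
    · have : derivative ℚ (PowerSeries.map (Polynomial.evalRingHom (0 : ℚ)) Φ) =
          PowerSeries.map (Polynomial.evalRingHom (0 : ℚ)) (derivative _ Φ) := by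
        ext1 n; simp [coeff_derivative]
      rw [this, hΦ]
      simp [z]
    · simp [hΦ0, constantCoeff_map_apply]
  have hq := eq_abelPoly_of_derivative (q := fun n => coeff n Φ) (by simpa using hΦ0)
    (fun n => by simpa using congrArg (coeff (n + 1)) hev)
    (fun n => by
      have := congrArg (coeff (n + 1)) hkey
      rw [coeff_succ_X_mul, show (2 : (Polynomial ℚ)⟦X⟧) = PowerSeries.C 2 from rfl,
        coeff_C_mul] at this
      simpa [D, σ] using this) n
  have hy1 : coeff (n + 1) y = (Polynomial.derivative (coeff (n + 1) Φ)).eval 0 := by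
    have h1 := congrArg (PowerSeries.map (Polynomial.evalRingHom (0 : ℚ))) hDΦ
    rw [map_mul, hev, mul_one] at h1
    have := congrArg (coeff (n + 1)) h1
    simp [D, ι] at this
    exact this.symm
  have h3 := congrArg (fun p => (Polynomial.derivative p).eval 0) hq
  simp only [Polynomial.derivative_C_mul, Polynomial.eval_mul, Polynomial.eval_C, ← hy1] at h3
  rw [h3]
  simp [abelPoly, Polynomial.eval_finsetSum]

lemma lagrange_of_recurrence {p b : ℕ → ℚ} (h1 : b 1 = 1)
    (hp : ∀ n : ℕ, 2 * p (n + 1) = (n + 1) * ((if n = 0 then 1 else 0) + b (n + 1)))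
    (hrec : ∀ n, b (n + 2) =
      ∑ i ∈ Finset.range (n + 1), (n.choose i : ℚ) * (p (i + 1) * b (n - i + 1))) (n : ℕ) :
    2 ^ (n + 1) * p (n + 1) =
      ∑ k ∈ Finset.range (n + 2), ((n + 1).choose k : ℚ) * (k : ℚ) ^ n := by
  have hf (n : ℕ) : (n.factorial : ℚ) ≠ 0 := by exact_mod_cast n.factorial_ne_zero
  have key := lagrange_step
    (y := PowerSeries.mk fun n => if n = 0 then 0 else p n / (n.factorial : ℚ))
    (G := PowerSeries.mk fun n => b (n + 1) / (n.factorial : ℚ))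
    (by simp [← coeff_zero_eq_constantCoeff_apply])
    (by simp [← coeff_zero_eq_constantCoeff_apply, h1]) ?_ ?_ n
  · rw [← key]
    simp only [coeff_mk, Nat.succ_ne_zero, if_false]
    have := hf (n + 1)
    field_simp
  · ext n
    rw [coeff_derivative, coeff_mul, Finset.Nat.sum_antidiagonal_eq_sum_range_succ_mk, coeff_mk,
      hrec, Finset.sum_div, Finset.sum_mul]
    refine Finset.sum_congr rfl fun i hi => ?_
    have hi' : i ≤ n := by have := Finset.mem_range.mp hi; omega
    simp only [coeff_derivative, coeff_mk, Nat.succ_ne_zero, if_false]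
    rw [Nat.cast_choose ℚ hi', Nat.factorial_succ, Nat.factorial_succ]
    have := hf n
    have := hf i
    have := hf (n - i)
    have : (n + 1 : ℚ) ≠ 0 := by positivity
    have : (i + 1 : ℚ) ≠ 0 := by positivity
    push_cast
    field_simp
  · ext n
    rw [show (2 : ℚ⟦X⟧) = PowerSeries.C 2 from rfl, coeff_C_mul]
    cases n with
    | zero => simp
    | succ n =>
      rw [coeff_succ_X_mul, map_add, coeff_one, coeff_mk, coeff_mk, if_neg (Nat.succ_ne_zero n),
        ← mul_div_assoc, hp, Nat.factorial_succ]
      have := hf n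
      have : (n + 1 : ℚ) ≠ 0 := by positivity
      push_cast
      field_simp
      split_ifs with h
      · simp [h]
      · simp

end Algebra

/-- A maxmin tree on `V`, given by its edge set and the set `U` of vertices in the upper tier. -/
def IsMaxminOn (V : Finset ℕ) (E : Finset (Sym2 ℕ)) (U : Finset ℕ) : Prop :=
  IsTreeOn V E ∧ U ⊆ V ∧ ∀ a b : ℕ, s(a, b) ∈ E → a < b → a ∉ U ∧ b ∈ U

/-- The maxmin trees on `V`. -/
noncomputable def maxminTrees (V : Finset ℕ) : Finset (Finset (Sym2 ℕ) × Finset ℕ) :=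
  (V.sym2.powerset ×ˢ V.powerset).filter fun T => IsMaxminOn V T.1 T.2

/-- The maxmin trees on `V` with a marked vertex in the lower tier. -/
noncomputable def lowerMarkedTrees (V : Finset ℕ) : Finset ((Finset (Sym2 ℕ) × Finset ℕ) × ℕ) :=
  (maxminTrees V ×ˢ V).filter fun T => T.2 ∉ T.1.2

/-- The maxmin trees on `V` with a marked vertex in the upper tier. -/
noncomputable def upperMarkedTrees (V : Finset ℕ) : Finset ((Finset (Sym2 ℕ) × Finset ℕ) × ℕ) :=
  (maxminTrees V ×ˢ V).filter fun T => T.2 ∈ T.1.2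

/-- The maxmin trees on `V` in which `M` lies in the upper tier. -/
noncomputable def topTrees (V : Finset ℕ) (M : ℕ) : Finset (Finset (Sym2 ℕ) × Finset ℕ) :=
  (maxminTrees V).filter fun T => M ∈ T.2

lemma IsTreeOn.mem_of_mem {V : Finset ℕ} {E : Finset (Sym2 ℕ)} (h : IsTreeOn V E) {a b : ℕ}
    (hab : s(a, b) ∈ E) : a ∈ V ∧ b ∈ V :=
  ⟨h.1 _ hab a (Sym2.mem_mk_left a b), h.1 _ hab b (Sym2.mem_mk_right a b)⟩

lemma IsTreeOn.ne_of_mem {V : Finset ℕ} {E : Finset (Sym2 ℕ)} (h : IsTreeOn V E) {a b : ℕ}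
    (hab : s(a, b) ∈ E) : a ≠ b := fun hh => h.2.1 _ hab (by simpa using hh)

lemma mem_maxminTrees {V : Finset ℕ} {T : Finset (Sym2 ℕ) × Finset ℕ} :
    T ∈ maxminTrees V ↔ IsMaxminOn V T.1 T.2 := by
  simp only [maxminTrees, Finset.mem_filter, Finset.mem_product, Finset.mem_powerset,
    and_iff_right_iff_imp]
  exact fun h => ⟨fun e he => Finset.mem_sym2_iff.mpr (h.1.1 e he), h.2.1⟩

lemma mem_lowerMarkedTrees {V : Finset ℕ} {T : (Finset (Sym2 ℕ) × Finset ℕ) × ℕ} :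
    T ∈ lowerMarkedTrees V ↔ IsMaxminOn V T.1.1 T.1.2 ∧ T.2 ∈ V ∧ T.2 ∉ T.1.2 := by
  simp only [lowerMarkedTrees, Finset.mem_filter, Finset.mem_product, mem_maxminTrees, and_assoc]

lemma mem_upperMarkedTrees {V : Finset ℕ} {T : (Finset (Sym2 ℕ) × Finset ℕ) × ℕ} :
    T ∈ upperMarkedTrees V ↔ IsMaxminOn V T.1.1 T.1.2 ∧ T.2 ∈ V ∧ T.2 ∈ T.1.2 := by
  simp only [upperMarkedTrees, Finset.mem_filter, Finset.mem_product, mem_maxminTrees, and_assoc]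

lemma mem_topTrees {V : Finset ℕ} {M : ℕ} {T : Finset (Sym2 ℕ) × Finset ℕ} :
    T ∈ topTrees V M ↔ IsMaxminOn V T.1 T.2 ∧ M ∈ T.2 := by
  simp only [topTrees, Finset.mem_filter, mem_maxminTrees]

lemma EReach.symm {E : Finset (Sym2 ℕ)} {a b : ℕ} (h : EReach E a b) : EReach E b a := by
  induction h with
  | refl => exact Relation.ReflTransGen.refl
  | tail _ hbc ih => exact Relation.ReflTransGen.head (by rwa [Sym2.eq_swap]) ih

lemma EReach.trans {E : Finset (Sym2 ℕ)} {a b c : ℕ} (h : EReach E a b) (h' : EReach E b c) :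
    EReach E a c := Relation.ReflTransGen.trans h h'

lemma EReach.mono {E F : Finset (Sym2 ℕ)} (hEF : E ⊆ F) {a b : ℕ} (h : EReach E a b) :
    EReach F a b := Relation.ReflTransGen.mono (fun _ _ hx => hEF hx) _ _ h

lemma EReach.image {E : Finset (Sym2 ℕ)} (f : ℕ → ℕ) {a b : ℕ} (h : EReach E a b) :
    EReach (E.image (Sym2.map f)) (f a) (f b) :=
  Relation.ReflTransGen.lift f
    (fun x y hxy => Finset.mem_image.mpr ⟨s(x, y), hxy, Sym2.map_mk f x y⟩) _ _ h

lemma EReach.exists_leaving {E : Finset (Sym2 ℕ)} {S : Finset ℕ} {a b : ℕ} (h : EReach E a b)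
    (ha : a ∈ S) (hb : b ∉ S) : ∃ x ∈ S, ∃ y ∉ S, s(x, y) ∈ E := by
  induction h with
  | refl => exact absurd ha hb
  | @tail c d _ hcd ih =>
    by_cases hc : c ∈ S
    · exact ⟨c, hc, d, hb, hcd⟩
    · exact ih hc

lemma card_le_of_connected {V : Finset ℕ} {E : Finset (Sym2 ℕ)} {r : ℕ}
    (h : ∀ x ∈ V, EReach E r x) : V.card ≤ E.card + 1 := by
  have key : ∀ k, k + 1 ≤ V.card → ∃ (S : Finset ℕ) (F : Finset (Sym2 ℕ)), r ∈ S ∧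
      S.card = k + 1 ∧ F ⊆ E ∧ F.card = k ∧ ∀ e ∈ F, ∀ x ∈ e, x ∈ S := by
    intro k
    induction k with
    | zero => exact fun _ => ⟨{r}, ∅, by simp⟩
    | succ k ih =>
      intro hk
      obtain ⟨S, F, hr, hS, hFE, hF, hFS⟩ := ih (by omega)
      obtain ⟨x, hxV, hxS⟩ := Finset.exists_mem_notMem_of_card_lt_card
        (show S.card < V.card by omega)
      obtain ⟨a, ha, b, hb, hab⟩ := (h x hxV).exists_leaving hr hxS
      have hnew : s(a, b) ∉ F := fun hh => hb (hFS _ hh b (Sym2.mem_mk_right a b))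
      refine ⟨insert b S, insert s(a, b) F, Finset.mem_insert_of_mem hr, ?_, ?_, ?_, ?_⟩
      · rw [Finset.card_insert_of_notMem hb, hS]
      · exact Finset.insert_subset hab hFE
      · rw [Finset.card_insert_of_notMem hnew, hF]
      · intro e he x hx
        rcases Finset.mem_insert.mp he with rfl | he
        · rcases Sym2.mem_iff.mp hx with rfl | rfl <;> simp [ha]
        · exact Finset.mem_insert_of_mem (hFS e he x hx)
  by_contra hcon
  obtain ⟨S, F, -, -, hFE, hF, -⟩ := key (V.card - 1) (by omega)
  have := Finset.card_le_card hFE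
  omega

lemma Sym2.map_injOn_of_injOn {V : Finset ℕ} {f : ℕ → ℕ} (hf : Set.InjOn f V) {e e' : Sym2 ℕ}
    (he : ∀ x ∈ e, x ∈ V) (he' : ∀ x ∈ e', x ∈ V) (h : Sym2.map f e = Sym2.map f e') :
    e = e' := by
  induction e with
  | _ a b =>
  induction e' with
  | _ c d =>
  have ha := he a (Sym2.mem_mk_left a b)
  have hb := he b (Sym2.mem_mk_right a b)
  have hc := he' c (Sym2.mem_mk_left c d)
  have hd := he' d (Sym2.mem_mk_right c d)
  rw [Sym2.map_mk, Sym2.map_mk, Sym2.eq_iff] at h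
  rw [Sym2.eq_iff]
  rcases h with ⟨h1, h2⟩ | ⟨h1, h2⟩
  · exact Or.inl ⟨hf ha hc h1, hf hb hd h2⟩
  · exact Or.inr ⟨hf ha hd h1, hf hb hc h2⟩

lemma IsTreeOn.image {V : Finset ℕ} {E : Finset (Sym2 ℕ)} {f : ℕ → ℕ} (hf : Set.InjOn f V)
    (h : IsTreeOn V E) : IsTreeOn (V.image f) (E.image (Sym2.map f)) := by
  refine ⟨?_, ?_, ?_, ?_⟩
  · intro e' he' x hx
    obtain ⟨e, he, rfl⟩ := Finset.mem_image.mp he'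
    obtain ⟨y, hy, rfl⟩ := Sym2.mem_map.mp hx
    exact Finset.mem_image_of_mem f (h.1 e he y hy)
  · intro e' he'
    obtain ⟨e, he, rfl⟩ := Finset.mem_image.mp he'
    induction e with
    | _ a b =>
      rw [Sym2.map_mk, Sym2.mk_isDiag_iff]
      exact fun hh => h.ne_of_mem he (hf (h.mem_of_mem he).1 (h.mem_of_mem he).2 hh)
  · intro a' ha' b' hb'
    obtain ⟨a, ha, rfl⟩ := Finset.mem_image.mp ha'
    obtain ⟨b, hb, rfl⟩ := Finset.mem_image.mp hb'
    exact (h.2.2.1 a ha b hb).image f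
  · rw [Finset.card_image_of_injOn hf, Finset.card_image_of_injOn, h.2.2.2]
    exact fun e he e' he' hee => Sym2.map_injOn_of_injOn hf (h.1 e he) (h.1 e' he') hee

lemma Finset.subset_of_image_subset {α β : Type*} [DecidableEq β] {s t : Finset α} {V : Set α} {f : α → β}
    (hf : Set.InjOn f V) (hs : ∀ x ∈ s, x ∈ V) (ht : ∀ x ∈ t, x ∈ V)
    (h : s.image f ⊆ t.image f) : s ⊆ t := by
  intro x hx
  obtain ⟨y, hy, hxy⟩ := Finset.mem_image.mp (h (Finset.mem_image_of_mem f hx))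
  rwa [← hf (ht y hy) (hs x hx) hxy]

lemma Finset.eq_of_image_eq {α β : Type*} [DecidableEq β] {s t : Finset α} {V : Set α} {f : α → β}
    (hf : Set.InjOn f V) (hs : ∀ x ∈ s, x ∈ V) (ht : ∀ x ∈ t, x ∈ V)
    (h : s.image f = t.image f) : s = t :=
  (Finset.subset_of_image_subset hf hs ht h.le).antisymm
    (Finset.subset_of_image_subset hf ht hs h.ge)

lemma IsMaxminOn.reverse {V : Finset ℕ} {E : Finset (Sym2 ℕ)} {U : Finset ℕ} {f : ℕ → ℕ}
    (hf : StrictAntiOn f V) (h : IsMaxminOn V E U) :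
    IsMaxminOn (V.image f) (E.image (Sym2.map f)) ((V \ U).image f) := by
  refine ⟨h.1.image hf.injOn, Finset.image_subset_image Finset.sdiff_subset, ?_⟩
  have hmem : ∀ x ∈ V, f x ∈ (V \ U).image f ↔ x ∉ U := by
    intro x hx
    constructor
    · intro hfx
      obtain ⟨y, hy, hxy⟩ := Finset.mem_image.mp hfx
      obtain ⟨hyV, hyU⟩ := Finset.mem_sdiff.mp hy
      rwa [← hf.injOn hyV hx hxy]
    · exact fun hxU => Finset.mem_image_of_mem f (Finset.mem_sdiff.mpr ⟨hx, hxU⟩)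
  have key : ∀ a b, s(a, b) ∈ E → f a < f b →
      f a ∉ (V \ U).image f ∧ f b ∈ (V \ U).image f := by
    intro a b hab hlt
    obtain ⟨ha, hb⟩ := h.1.mem_of_mem hab
    have hba : b < a := (hf.lt_iff_gt ha hb).mp hlt
    have := h.2.2 b a (by rwa [Sym2.eq_swap]) hba
    rw [hmem a ha, hmem b hb]
    exact ⟨fun hh => hh this.2, this.1⟩
  intro a b hab hlt
  obtain ⟨e, he, hee⟩ := Finset.mem_image.mp hab
  induction e with
  | _ c d =>
    rw [Sym2.map_mk, Sym2.eq_iff] at hee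
    rcases hee with ⟨rfl, rfl⟩ | ⟨rfl, rfl⟩
    · exact key c d he hlt
    · exact key d c (by rwa [Sym2.eq_swap]) hlt

lemma reverse_injOn {V : Finset ℕ} {f : ℕ → ℕ} (hf : Set.InjOn f V)
    {s : Set ((Finset (Sym2 ℕ) × Finset ℕ) × ℕ)}
    (hs : ∀ T ∈ s, IsMaxminOn V T.1.1 T.1.2 ∧ T.2 ∈ V) :
    Set.InjOn (fun T : (Finset (Sym2 ℕ) × Finset ℕ) × ℕ =>
      ((T.1.1.image (Sym2.map f), (V \ T.1.2).image f), f T.2)) s := by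
  rintro ⟨⟨E, U⟩, u⟩ hT ⟨⟨E', U'⟩, u'⟩ hT' heq
  obtain ⟨h, hu⟩ := hs _ hT
  obtain ⟨h', hu'⟩ := hs _ hT'
  simp only [Prod.mk.injEq] at heq h h' hu hu' ⊢
  obtain ⟨⟨hE, hU⟩, huu⟩ := heq
  refine ⟨⟨?_, ?_⟩, hf hu hu' huu⟩
  · exact Finset.eq_of_image_eq (V := {e : Sym2 ℕ | ∀ x ∈ e, x ∈ V})
      (fun e he e' he' hee => Sym2.map_injOn_of_injOn hf he he' hee) h.1.1 h'.1.1 hE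
  · have := Finset.eq_of_image_eq hf (fun x hx => (Finset.mem_sdiff.mp hx).1)
      (fun x hx => (Finset.mem_sdiff.mp hx).1) hU
    rw [← Finset.sdiff_sdiff_eq_self h.2.1, this, Finset.sdiff_sdiff_eq_self h'.2.1]

lemma card_lower_le_card_upper {V : Finset ℕ} {f : ℕ → ℕ} (hf : StrictAntiOn f V) :
    (lowerMarkedTrees V).card ≤ (upperMarkedTrees (V.image f)).card := by
  refine Finset.card_le_card_of_injOn _ ?_ (reverse_injOn hf.injOn
    fun T hT => ⟨(mem_lowerMarkedTrees.mp hT).1, (mem_lowerMarkedTrees.mp hT).2.1⟩)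
  intro T hT
  obtain ⟨h, hu, huU⟩ := mem_lowerMarkedTrees.mp hT
  exact mem_upperMarkedTrees.mpr ⟨h.reverse hf, Finset.mem_image_of_mem f hu,
    Finset.mem_image_of_mem f (Finset.mem_sdiff.mpr ⟨hu, huU⟩)⟩

lemma card_upper_le_card_lower {V : Finset ℕ} {f : ℕ → ℕ} (hf : StrictAntiOn f V) :
    (upperMarkedTrees V).card ≤ (lowerMarkedTrees (V.image f)).card := by
  refine Finset.card_le_card_of_injOn _ ?_ (reverse_injOn hf.injOn
    fun T hT => ⟨(mem_upperMarkedTrees.mp hT).1, (mem_upperMarkedTrees.mp hT).2.1⟩)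
  intro T hT
  obtain ⟨h, hu, huU⟩ := mem_upperMarkedTrees.mp hT
  refine mem_lowerMarkedTrees.mpr ⟨h.reverse hf, Finset.mem_image_of_mem f hu, fun hh => ?_⟩
  obtain ⟨y, hy, hyu⟩ := Finset.mem_image.mp hh
  obtain ⟨hyV, hyU⟩ := Finset.mem_sdiff.mp hy
  exact hyU (hf.injOn hyV hu hyu ▸ huU)

lemma exists_strictAntiOn_image_eq {V W : Finset ℕ} (h : V.card = W.card) :
    ∃ f : ℕ → ℕ, StrictAntiOn f V ∧ V.image f = W := by
  let e := V.orderIsoOfFin rfl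
  let e' := W.orderIsoOfFin h.symm
  have hanti : StrictAntiOn
      (fun x => if hx : x ∈ V then (e' (e.symm ⟨x, hx⟩).rev : ℕ) else 0) V := by
    intro x hx y hy hxy
    simp only [Finset.mem_coe] at hx hy
    simp only [hx, hy, dif_pos, Subtype.coe_lt_coe, OrderIso.lt_iff_lt, Fin.rev_lt_rev,
      Subtype.mk_lt_mk, hxy]
  refine ⟨_, hanti, Finset.eq_of_subset_of_card_le ?_ ?_⟩
  · intro z hz
    obtain ⟨x, hx, rfl⟩ := Finset.mem_image.mp hz
    simp only [hx, dif_pos, Finset.coe_mem]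
  · rw [Finset.card_image_of_injOn hanti.injOn, h]

lemma card_lower_le_card_upper_of_card_eq {V W : Finset ℕ} (h : V.card = W.card) :
    (lowerMarkedTrees V).card ≤ (upperMarkedTrees W).card := by
  obtain ⟨f, hf, rfl⟩ := exists_strictAntiOn_image_eq h
  exact card_lower_le_card_upper hf

lemma card_upper_le_card_lower_of_card_eq {V W : Finset ℕ} (h : V.card = W.card) :
    (upperMarkedTrees V).card ≤ (lowerMarkedTrees W).card := by
  obtain ⟨f, hf, rfl⟩ := exists_strictAntiOn_image_eq h
  exact card_upper_le_card_lower hf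

lemma card_lower_eq_of_card_eq {V W : Finset ℕ} (h : V.card = W.card) :
    (lowerMarkedTrees V).card = (lowerMarkedTrees W).card :=
  le_antisymm
    ((card_lower_le_card_upper_of_card_eq rfl).trans (card_upper_le_card_lower_of_card_eq h))
    ((card_lower_le_card_upper_of_card_eq rfl).trans (card_upper_le_card_lower_of_card_eq h.symm))

lemma two_mul_card_lower (V : Finset ℕ) :
    2 * (lowerMarkedTrees V).card = V.card * (maxminTrees V).card := by
  have h : (lowerMarkedTrees V).card = (upperMarkedTrees V).card :=
    le_antisymm (card_lower_le_card_upper_of_card_eq rfl) (card_upper_le_card_lower_of_card_eq rfl)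
  have h' := Finset.card_filter_add_card_filter_not (s := maxminTrees V ×ˢ V)
    (fun T => T.2 ∈ T.1.2)
  rw [Finset.card_product, mul_comm] at h'
  rw [two_mul, ← h']
  nth_rw 1 [h]
  rfl

lemma IsTreeOn.glue {C D : Finset ℕ} {E₁ E₂ : Finset (Sym2 ℕ)} {u M : ℕ} (hCD : Disjoint C D)
    (h₁ : IsTreeOn C E₁) (h₂ : IsTreeOn D E₂) (hu : u ∈ C) (hM : M ∈ D) :
    IsTreeOn (C ∪ D) (insert s(u, M) (E₁ ∪ E₂)) := by
  have huM : EReach (insert s(u, M) (E₁ ∪ E₂)) u M :=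
    Relation.ReflTransGen.single (Finset.mem_insert_self _ _)
  have hE₁ : E₁ ⊆ insert s(u, M) (E₁ ∪ E₂) :=
    Finset.subset_union_left.trans (Finset.subset_insert _ _)
  have hE₂ : E₂ ⊆ insert s(u, M) (E₁ ∪ E₂) :=
    Finset.subset_union_right.trans (Finset.subset_insert _ _)
  have hreach : ∀ a ∈ C ∪ D, EReach (insert s(u, M) (E₁ ∪ E₂)) u a := by
    intro a ha
    rcases Finset.mem_union.mp ha with ha | ha
    · exact (h₁.2.2.1 u hu a ha).mono hE₁
    · exact huM.trans ((h₂.2.2.1 M hM a ha).mono hE₂)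
  refine ⟨?_, ?_, fun a ha b hb => (hreach a ha).symm.trans (hreach b hb), ?_⟩
  · intro e he x hx
    rcases Finset.mem_insert.mp he with rfl | he
    · rcases Sym2.mem_iff.mp hx with rfl | rfl <;> simp [hu, hM]
    · rcases Finset.mem_union.mp he with he | he
      · exact Finset.mem_union_left _ (h₁.1 e he x hx)
      · exact Finset.mem_union_right _ (h₂.1 e he x hx)
  · intro e he
    rcases Finset.mem_insert.mp he with rfl | he
    · rw [Sym2.mk_isDiag_iff]
      rintro rfl
      exact Finset.disjoint_left.mp hCD hu hM
    · rcases Finset.mem_union.mp he with he | he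
      · exact h₁.2.1 e he
      · exact h₂.2.1 e he
  · have hdisj : Disjoint E₁ E₂ := by
      rw [Finset.disjoint_left]
      intro e he he'
      induction e with
      | _ a b => exact Finset.disjoint_left.mp hCD (h₁.mem_of_mem he).1 (h₂.mem_of_mem he').1
    have hnew : s(u, M) ∉ E₁ ∪ E₂ := by
      intro he
      rcases Finset.mem_union.mp he with he | he
      · exact Finset.disjoint_left.mp hCD (h₁.mem_of_mem he).2 hM
      · exact Finset.disjoint_left.mp hCD hu (h₂.mem_of_mem he).1
    rw [Finset.card_insert_of_notMem hnew, Finset.card_union_of_disjoint hdisj,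
      Finset.card_union_of_disjoint hCD, ← h₁.2.2.2, ← h₂.2.2.2]
    omega

lemma IsMaxminOn.glue {C D : Finset ℕ} {E₁ E₂ : Finset (Sym2 ℕ)} {U₁ U₂ : Finset ℕ} {u M : ℕ}
    (hCD : Disjoint C D) (h₁ : IsMaxminOn C E₁ U₁) (h₂ : IsMaxminOn D E₂ U₂) (hu : u ∈ C)
    (huU : u ∉ U₁) (hM : M ∈ U₂) (huM : u < M) :
    IsMaxminOn (C ∪ D) (insert s(u, M) (E₁ ∪ E₂)) (U₁ ∪ U₂) := by
  refine ⟨h₁.1.glue hCD h₂.1 hu (h₂.2.1 hM), Finset.union_subset_union h₁.2.1 h₂.2.1, ?_⟩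
  intro a b hab hlt
  have hC : ∀ x ∈ C, x ∉ U₂ := fun x hx hx' => Finset.disjoint_left.mp hCD hx (h₂.2.1 hx')
  have hD : ∀ x ∈ D, x ∉ U₁ := fun x hx hx' => Finset.disjoint_left.mp hCD (h₁.2.1 hx') hx
  simp only [Finset.mem_union, not_or]
  rcases Finset.mem_insert.mp hab with hab | hab
  · rcases Sym2.eq_iff.mp hab with ⟨rfl, rfl⟩ | ⟨rfl, rfl⟩
    · exact ⟨⟨huU, hC _ hu⟩, Or.inr hM⟩
    · omega
  · rcases Finset.mem_union.mp hab with hab | hab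
    · have := h₁.2.2 a b hab hlt
      exact ⟨⟨this.1, hC _ (h₁.1.mem_of_mem hab).1⟩, Or.inl this.2⟩
    · have := h₂.2.2 a b hab hlt
      exact ⟨⟨hD _ (h₂.1.mem_of_mem hab).1, this.1⟩, Or.inr this.2⟩

lemma IsMaxminOn.restrict {V C : Finset ℕ} {E F : Finset (Sym2 ℕ)} {U : Finset ℕ}
    (h : IsMaxminOn V E U) (hF : IsTreeOn C F) (hFE : F ⊆ E) : IsMaxminOn C F (U ∩ C) := by
  refine ⟨hF, Finset.inter_subset_right, fun a b hab hlt => ?_⟩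
  have := h.2.2 a b (hFE hab) hlt
  exact ⟨fun ha => this.1 (Finset.mem_inter.mp ha).1,
    Finset.mem_inter.mpr ⟨this.2, (hF.mem_of_mem hab).2⟩⟩

lemma reach_glue_iff {C D : Finset ℕ} {E₁ E₂ : Finset (Sym2 ℕ)} {u M m : ℕ}
    (hCD : Disjoint C D) (h₁ : IsTreeOn C E₁) (h₂ : IsTreeOn D E₂) (hM : M ∈ D)
    (hm : m ∈ C) (x : ℕ) :
    EReach ((insert s(u, M) (E₁ ∪ E₂)).filter fun e => M ∉ e) m x ↔ x ∈ C := by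
  constructor
  · intro h
    by_contra hx
    obtain ⟨a, ha, b, hb, hab⟩ := h.exists_leaving hm hx
    obtain ⟨hab, hMab⟩ := Finset.mem_filter.mp hab
    rcases Finset.mem_insert.mp hab with hab | hab
    · exact hMab (hab ▸ Sym2.mem_mk_right u M)
    · rcases Finset.mem_union.mp hab with hab | hab
      · exact hb (h₁.mem_of_mem hab).2
      · exact Finset.disjoint_left.mp hCD ha (h₂.mem_of_mem hab).1
  · intro hx
    refine (h₁.2.2.1 m hm x hx).mono fun e he => ?_
    refine Finset.mem_filter.mpr ⟨Finset.mem_insert_of_mem (Finset.mem_union_left _ he), ?_⟩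
    exact fun hMe => Finset.disjoint_left.mp hCD (h₁.1 e he M hMe) hM

lemma IsTreeOn.exists_split {V : Finset ℕ} {E : Finset (Sym2 ℕ)} {m M : ℕ} (h : IsTreeOn V E)
    (hm : m ∈ V) (hM : M ∈ V) (hmM : m ≠ M) :
    ∃ C ⊆ V, m ∈ C ∧ M ∉ C ∧ ∃ u ∈ C, ∃ E₁ E₂ : Finset (Sym2 ℕ), IsTreeOn C E₁ ∧
      IsTreeOn (V \ C) E₂ ∧ E = insert s(u, M) (E₁ ∪ E₂) := by
  let F := E.filter fun e => M ∉ e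
  let C := V.filter fun x => EReach F m x
  have hmC : m ∈ C := Finset.mem_filter.mpr ⟨hm, Relation.ReflTransGen.refl⟩
  have hMC : M ∉ C := by
    intro hh
    have hr := (Finset.mem_filter.mp hh).2
    obtain ⟨a, ha, b, hb, hab⟩ := hr.exists_leaving (S := V.erase M)
      (Finset.mem_erase.mpr ⟨hmM, hm⟩) (Finset.notMem_erase M V)
    obtain ⟨hab, hMab⟩ := Finset.mem_filter.mp hab
    have hbM : b ≠ M := by rintro rfl; exact hMab (Sym2.mem_mk_right a b)
    exact hb (Finset.mem_erase.mpr ⟨hbM, (h.mem_of_mem hab).2⟩)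
  have hleave : ∀ a b, a ∈ C → b ∉ C → s(a, b) ∈ E → b = M := by
    intro a b ha hb hab
    by_contra hbM
    have haM : a ≠ M := by rintro rfl; exact hMC ha
    refine hb (Finset.mem_filter.mpr ⟨(h.mem_of_mem hab).2, ?_⟩)
    refine (Finset.mem_filter.mp ha).2.tail (Finset.mem_filter.mpr ⟨hab, ?_⟩)
    rw [Sym2.mem_iff]
    rintro (rfl | rfl) <;> contradiction
  let E₁ := E.filter fun e => ∀ x ∈ e, x ∈ C
  let E₂ := E.filter fun e => ∀ x ∈ e, x ∉ C
  have hmem₁ : ∀ a b, s(a, b) ∈ E₁ ↔ s(a, b) ∈ E ∧ a ∈ C ∧ b ∈ C := by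
    intro a b; simp [E₁]
  have hmem₂ : ∀ a b, s(a, b) ∈ E₂ ↔ s(a, b) ∈ E ∧ a ∉ C ∧ b ∉ C := by
    intro a b; simp [E₂]
  have hreach₁ : ∀ x ∈ C, EReach E₁ m x := by
    intro x hx
    have hr := (Finset.mem_filter.mp hx).2
    clear hx
    induction hr with
    | refl => exact Relation.ReflTransGen.refl
    | @tail b c hmb hbc ih =>
      refine ih.tail ((hmem₁ b c).mpr ?_)
      have hbcE := (Finset.mem_filter.mp hbc).1
      exact ⟨hbcE, Finset.mem_filter.mpr ⟨(h.mem_of_mem hbcE).1, hmb⟩,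
        Finset.mem_filter.mpr ⟨(h.mem_of_mem hbcE).2, hmb.tail hbc⟩⟩
  have hreach₂ : ∀ x ∈ V \ C, EReach E₂ x M := by
    intro x hx
    obtain ⟨hxV, hxC⟩ := Finset.mem_sdiff.mp hx
    have hr := h.2.2.1 x hxV M hM
    clear hx hxV
    induction hr using Relation.ReflTransGen.head_induction_on with
    | refl => exact Relation.ReflTransGen.refl
    | @head a b hab _ ih =>
      by_cases hb : b ∈ C
      · rw [hleave b a hb hxC (by rwa [Sym2.eq_swap])]
        exact Relation.ReflTransGen.refl
      · exact (ih hb).head ((hmem₂ a b).mpr ⟨hab, hxC, hb⟩)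
  have hMV : M ∈ V \ C := Finset.mem_sdiff.mpr ⟨hM, hMC⟩
  have hc₁ := card_le_of_connected hreach₁
  have hc₂ := card_le_of_connected fun x hx => (hreach₂ x hx).symm
  obtain ⟨u, hu, b, hb, hub⟩ := (h.2.2.1 m hm M hM).exists_leaving hmC hMC
  obtain rfl := hleave u b hu hb hub
  have hsub : insert s(u, b) (E₁ ∪ E₂) ⊆ E :=
    Finset.insert_subset hub
      (Finset.union_subset (Finset.filter_subset _ _) (Finset.filter_subset _ _))
  have hdisj : Disjoint E₁ E₂ := by
    rw [Finset.disjoint_left]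
    intro e he he'
    induction e with
    | _ a b => exact ((hmem₂ a b).mp he').2.1 ((hmem₁ a b).mp he).2.1
  have hnew : s(u, b) ∉ E₁ ∪ E₂ := by
    rw [Finset.mem_union, hmem₁, hmem₂]
    tauto
  have hcard : (insert s(u, b) (E₁ ∪ E₂)).card = E₁.card + E₂.card + 1 := by
    rw [Finset.card_insert_of_notMem hnew, Finset.card_union_of_disjoint hdisj]
  have hle := Finset.card_le_card hsub
  have hVcard : (V \ C).card + C.card = V.card :=
    Finset.card_sdiff_add_card_eq_card (Finset.filter_subset _ _)
  have hE := h.2.2.2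
  refine ⟨C, Finset.filter_subset _ _, hmC, hMC, u, hu, E₁, E₂, ⟨?_, ?_, ?_, ?_⟩,
    ⟨?_, ?_, ?_, ?_⟩, (Finset.eq_of_subset_of_card_le hsub ?_).symm⟩
  · exact fun e he => (Finset.mem_filter.mp he).2
  · exact fun e he => h.2.1 e (Finset.mem_filter.mp he).1
  · exact fun x hx y hy => (hreach₁ x hx).symm.trans (hreach₁ y hy)
  · omega
  · exact fun e he x hx => Finset.mem_sdiff.mpr
      ⟨h.1 e (Finset.mem_filter.mp he).1 x hx, (Finset.mem_filter.mp he).2 x hx⟩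
  · exact fun e he => h.2.1 e (Finset.mem_filter.mp he).1
  · exact fun x hx y hy => (hreach₂ x hx).trans (hreach₂ y hy).symm
  · omega
  · omega

lemma glue_edges_left {C D : Finset ℕ} {E₁ E₂ : Finset (Sym2 ℕ)} {u M : ℕ}
    (hCD : Disjoint C D) (h₁ : IsTreeOn C E₁) (h₂ : IsTreeOn D E₂) (hM : M ∈ D) :
    (insert s(u, M) (E₁ ∪ E₂)).filter (fun e => ∀ x ∈ e, x ∈ C) = E₁ := by
  ext e
  induction e with
  | _ a b =>
    simp only [Finset.mem_filter, Finset.mem_insert, Finset.mem_union, Sym2.ball]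
    constructor
    · rintro ⟨hab | hab | hab, ha, hb⟩
      · rcases Sym2.eq_iff.mp hab with ⟨rfl, rfl⟩ | ⟨rfl, rfl⟩
        · exact absurd hM (Finset.disjoint_left.mp hCD hb)
        · exact absurd hM (Finset.disjoint_left.mp hCD ha)
      · exact hab
      · exact absurd (h₂.mem_of_mem hab).1 (Finset.disjoint_left.mp hCD ha)
    · exact fun hab => ⟨Or.inr (Or.inl hab), h₁.mem_of_mem hab⟩

lemma glue_edges_right {C D : Finset ℕ} {E₁ E₂ : Finset (Sym2 ℕ)} {u M : ℕ}
    (hCD : Disjoint C D) (h₁ : IsTreeOn C E₁) (h₂ : IsTreeOn D E₂) (hu : u ∈ C) :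
    (insert s(u, M) (E₁ ∪ E₂)).filter (fun e => ∀ x ∈ e, x ∈ D) = E₂ := by
  rw [Sym2.eq_swap, Finset.union_comm]
  exact glue_edges_left hCD.symm h₂ h₁ hu

lemma union_inter_eq_left {α : Type*} [DecidableEq α] {C D U₁ U₂ : Finset α} (hCD : Disjoint C D)
    (h₁ : U₁ ⊆ C) (h₂ : U₂ ⊆ D) : (U₁ ∪ U₂) ∩ C = U₁ := by
  rw [Finset.union_inter_distrib_right, Finset.inter_eq_left.mpr h₁,
    Finset.disjoint_iff_inter_eq_empty.mp (hCD.symm.mono_left h₂), Finset.union_empty]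

lemma card_maxminTrees_eq_sum {V : Finset ℕ} {m M : ℕ} (hm : m ∈ V) (hM : M ∈ V) (hmM : m ≠ M)
    (hmax : ∀ x ∈ V, x ≤ M) :
    (maxminTrees V).card = ∑ S ∈ ((V.erase M).erase m).powerset,
      (lowerMarkedTrees (insert m S)).card * (topTrees (V \ insert m S) M).card := by
  have hS : ∀ S ∈ ((V.erase M).erase m).powerset,
      m ∉ S ∧ insert m S ⊆ V ∧ M ∈ V \ insert m S := by
    intro S hS
    rw [Finset.mem_powerset] at hS
    refine ⟨fun hh => by simpa using hS hh, ?_, ?_⟩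
    · exact Finset.insert_subset hm fun x hx => by have := hS hx; simp at this; tauto
    · rw [Finset.mem_sdiff, Finset.mem_insert, not_or]
      exact ⟨hM, hmM.symm, fun hh => by simpa using hS hh⟩
  simp_rw [← Finset.card_product]
  rw [← Finset.card_sigma]
  symm
  refine Finset.card_nbij
    (fun x => (insert s(x.2.1.2, M) (x.2.1.1.1 ∪ x.2.2.1), x.2.1.1.2 ∪ x.2.2.2)) ?_ ?_ ?_
  · rintro ⟨S, ⟨⟨⟨E₁, U₁⟩, u⟩, ⟨E₂, U₂⟩⟩⟩ hx
    simp only [Finset.mem_coe, Finset.mem_sigma, Finset.mem_product, mem_lowerMarkedTrees,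
      mem_topTrees] at hx
    obtain ⟨hxS, ⟨h₁, hu, huU⟩, h₂, hMU⟩ := hx
    obtain ⟨hmS, hSV, hMS⟩ := hS S hxS
    have hlt : u < M := lt_of_le_of_ne (hmax u (hSV hu)) fun hh =>
      (Finset.mem_sdiff.mp hMS).2 (hh ▸ hu)
    rw [Finset.mem_coe, mem_maxminTrees]
    have := h₁.glue Finset.disjoint_sdiff h₂ hu huU hMU hlt
    rwa [Finset.union_sdiff_of_subset hSV] at this
  · rintro ⟨S, ⟨⟨⟨E₁, U₁⟩, u⟩, ⟨E₂, U₂⟩⟩⟩ hx ⟨S', ⟨⟨⟨E₁', U₁'⟩, u'⟩, ⟨E₂', U₂'⟩⟩⟩ hx' heq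
    simp only [Finset.mem_coe, Finset.mem_sigma, Finset.mem_product, mem_lowerMarkedTrees,
      mem_topTrees] at hx hx'
    simp only [Prod.mk.injEq] at heq
    obtain ⟨hE, hU⟩ := heq
    obtain ⟨hxS, ⟨h₁, hu, huU⟩, h₂, hMU⟩ := hx
    obtain ⟨hmS, hSV, hMS⟩ := hS S hxS
    obtain ⟨hxS', ⟨h₁', hu', huU'⟩, h₂', hMU'⟩ := hx'
    obtain ⟨hmS', hSV', hMS'⟩ := hS S' hxS'
    have hSS : S = S' := by
      have hins : insert m S = insert m S' := by
        ext x
        rw [← reach_glue_iff (u := u) Finset.disjoint_sdiff h₁.1 h₂.1 hMS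
            (Finset.mem_insert_self m S) x,
          ← reach_glue_iff (u := u') Finset.disjoint_sdiff h₁'.1 h₂'.1 hMS'
            (Finset.mem_insert_self m S') x, hE]
      rw [← Finset.erase_insert hmS, hins, Finset.erase_insert hmS']
    subst hSS
    have hE₁ : E₁ = E₁' := by
      rw [← glue_edges_left (u := u) Finset.disjoint_sdiff h₁.1 h₂.1 hMS, hE,
        glue_edges_left Finset.disjoint_sdiff h₁'.1 h₂'.1 hMS']
    have hE₂ : E₂ = E₂' := by
      rw [← glue_edges_right (M := M) Finset.disjoint_sdiff h₁.1 h₂.1 hu, hE,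
        glue_edges_right Finset.disjoint_sdiff h₁'.1 h₂'.1 hu']
    have hdisj : ∀ x ∈ insert m S, x ∉ V \ insert m S := fun x hx hx' =>
      (Finset.mem_sdiff.mp hx').2 hx
    have hU₁ : U₁ = U₁' := by
      rw [← union_inter_eq_left Finset.disjoint_sdiff h₁.2.1 h₂.2.1, hU,
        union_inter_eq_left Finset.disjoint_sdiff h₁'.2.1 h₂'.2.1]
    have hU₂ : U₂ = U₂' := by
      rw [← union_inter_eq_left Finset.sdiff_disjoint h₂.2.1 h₁.2.1, Finset.union_comm, hU,
        Finset.union_comm, union_inter_eq_left Finset.sdiff_disjoint h₂'.2.1 h₁'.2.1]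
    subst hE₁ hE₂ hU₁ hU₂
    have huu : u = u' := by
      have hmem : s(u, M) ∈ insert s(u', M) (E₁ ∪ E₂) := hE ▸ Finset.mem_insert_self _ _
      rcases Finset.mem_insert.mp hmem with hmem | hmem
      · rcases Sym2.eq_iff.mp hmem with ⟨h, -⟩ | ⟨h, h'⟩
        · exact h
        · exact h.trans h'
      · rcases Finset.mem_union.mp hmem with hmem | hmem
        · exact absurd hMS (hdisj M (h₁.1.mem_of_mem hmem).2)
        · exact absurd (h₂.1.mem_of_mem hmem).1 (hdisj u hu)
    rw [huu]
  · rintro ⟨E, U⟩ hT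
    rw [Finset.mem_coe, mem_maxminTrees] at hT
    obtain ⟨C, hCV, hmC, hMC, u, hu, E₁, E₂, h₁, h₂, hE⟩ := hT.1.exists_split hm hM hmM
    simp only at hE
    have hlt : u < M := lt_of_le_of_ne (hmax u (hCV hu)) fun hh => hMC (hh ▸ hu)
    have hUM := hT.2.2 u M (hE ▸ Finset.mem_insert_self _ _) hlt
    have hC : insert m (C.erase m) = C := Finset.insert_erase hmC
    refine ⟨⟨C.erase m, (((E₁, U ∩ C), u), (E₂, U ∩ (V \ C)))⟩, ?_, ?_⟩
    · simp only [Finset.mem_coe, Finset.mem_sigma, Finset.mem_product, mem_lowerMarkedTrees,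
        mem_topTrees, hC]
      refine ⟨?_, ⟨hT.restrict h₁ ?_, hu, ?_⟩, hT.restrict h₂ ?_, ?_⟩
      · rw [Finset.mem_powerset]
        refine Finset.erase_subset_erase m fun x hx => Finset.mem_erase.mpr ⟨?_, hCV hx⟩
        rintro rfl
        exact hMC hx
      · rw [hE]
        exact Finset.subset_union_left.trans (Finset.subset_insert _ _)
      · exact fun hh => hUM.1 (Finset.mem_inter.mp hh).1
      · rw [hE]
        exact Finset.subset_union_right.trans (Finset.subset_insert _ _)
      · exact Finset.mem_inter.mpr ⟨hUM.2, Finset.mem_sdiff.mpr ⟨hM, hMC⟩⟩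
    · simp only [Prod.mk.injEq]
      refine ⟨hE.symm, ?_⟩
      rw [← Finset.inter_union_distrib_left, Finset.union_sdiff_of_subset hCV,
        Finset.inter_eq_left.mpr hT.2.1]

lemma topTrees_eq_maxminTrees {V : Finset ℕ} {M : ℕ} (hM : M ∈ V) (hmax : ∀ x ∈ V, x ≤ M)
    (hV : 2 ≤ V.card) : topTrees V M = maxminTrees V := by
  refine Finset.filter_true_of_mem fun T hT => ?_
  rw [mem_maxminTrees] at hT
  obtain ⟨m, hm, hmM⟩ := Finset.exists_mem_ne (show 1 < V.card by omega) M
  obtain ⟨C, hCV, -, hMC, u, hu, E₁, E₂, -, -, hE⟩ := hT.1.exists_split hm hM hmM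
  have hlt : u < M := lt_of_le_of_ne (hmax u (hCV hu)) fun hh => hMC (hh ▸ hu)
  exact (hT.2.2 u M (hE ▸ Finset.mem_insert_self _ _) hlt).2

lemma maxminTrees_singleton (M : ℕ) : maxminTrees {M} = {(∅, ∅), (∅, {M})} := by
  ext ⟨E, U⟩
  rw [mem_maxminTrees]
  simp only [Finset.mem_insert, Finset.mem_singleton, Prod.mk.injEq, ← and_or_left]
  constructor
  · rintro ⟨⟨-, -, -, hc⟩, hU, -⟩
    exact ⟨by simpa using hc, Finset.subset_singleton_iff.mp hU⟩
  · rintro ⟨rfl, hU⟩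
    refine ⟨⟨by simp, by simp, ?_, by simp⟩, Finset.subset_singleton_iff.mpr hU, by simp⟩
    simp only [Finset.mem_singleton]
    rintro a rfl b rfl
    exact Relation.ReflTransGen.refl

lemma topTrees_singleton (M : ℕ) : (topTrees {M} M).card = 1 := by
  rw [topTrees, maxminTrees_singleton, Finset.filter_insert, Finset.filter_singleton]
  simp

lemma lowerMarkedTrees_singleton (M : ℕ) : (lowerMarkedTrees {M}).card = 1 := by
  have h := two_mul_card_lower {M}
  rw [maxminTrees_singleton, Finset.card_pair (by simp), Finset.card_singleton] at h
  omega

lemma Tcount_two (n : ℕ) : Tcount n 2 = (maxminTrees (Finset.Icc 1 n)).card := by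
  have hcard : Tcount n 2 = (TieredTrees n 2).ncard := rfl
  rw [hcard, ← Set.ncard_coe_finset]
  refine Set.ncard_congr (fun T _ => (T.1, (Finset.Icc 1 n).filter fun x => T.2 x = 2)) ?_ ?_ ?_
  · rintro ⟨E, t⟩ ⟨hE, ⟨ht, hlt⟩, -⟩
    rw [Finset.mem_coe, mem_maxminTrees]
    refine ⟨hE, Finset.filter_subset _ _, fun a b hab hlt' => ?_⟩
    have h := hlt a b hab hlt'
    obtain ⟨ha, hb⟩ := hE.mem_of_mem hab
    have hta := Finset.mem_Icc.mp (ht a ha)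
    have htb := Finset.mem_Icc.mp (ht b hb)
    simp only [Finset.mem_filter, hb, ha, true_and] at h hta htb ⊢
    omega
  · rintro ⟨E, t⟩ ⟨E', t'⟩ ⟨-, ⟨ht, -⟩, h0⟩ ⟨-, ⟨ht', -⟩, h0'⟩ heq
    simp only [Prod.mk.injEq] at heq ht ht' h0 h0' ⊢
    refine ⟨heq.1, funext fun x => ?_⟩
    by_cases hx : x ∈ Finset.Icc 1 n
    · have h := Finset.ext_iff.mp heq.2 x
      simp only [Finset.mem_filter, hx, true_and] at h
      have h1 := Finset.mem_Icc.mp (ht x hx)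
      have h2 := Finset.mem_Icc.mp (ht' x hx)
      omega
    · rw [h0 x hx, h0' x hx]
  · rintro ⟨E, U⟩ hT
    rw [Finset.mem_coe, mem_maxminTrees] at hT
    obtain ⟨hE, hU, hlt⟩ := hT
    refine ⟨(E, fun x => if x ∈ Finset.Icc 1 n then (if x ∈ U then 2 else 1) else 0),
      ⟨hE, ⟨?_, ?_⟩, ?_⟩, ?_⟩
    · intro v hv
      simp only [hv, if_true]
      split_ifs <;> simp
    · intro a b hab hab'
      have h := hlt a b hab hab'
      obtain ⟨ha, hb⟩ := hE.mem_of_mem hab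
      simp only at h
      simp only [ha, hb, if_true, h.1, h.2, if_false]
      omega
    · intro x hx
      simp only [hx, if_false]
    · simp only [Prod.mk.injEq, true_and]
      ext x
      rw [Finset.mem_filter]
      constructor
      · rintro ⟨hx, hx2⟩
        by_contra hxU
        simp [hx, hxU] at hx2
      · intro hx
        have := hU hx
        exact ⟨this, by rw [if_pos this, if_pos hx]⟩

/-- The number of maxmin trees on `n` vertices with a marked vertex in the lower tier. -/
noncomputable def lowerMarkedCount (n : ℕ) : ℕ := (lowerMarkedTrees (Finset.Icc 1 n)).card

/-- The number of maxmin trees on `n` vertices whose largest vertex is in the upper tier. -/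
noncomputable def topCount (n : ℕ) : ℕ := (topTrees (Finset.Icc 1 n) n).card

lemma card_lowerMarkedTrees (V : Finset ℕ) :
    (lowerMarkedTrees V).card = lowerMarkedCount V.card :=
  card_lower_eq_of_card_eq (by simp)

lemma card_maxminTrees (V : Finset ℕ) (hV : V.Nonempty) :
    (maxminTrees V).card = (maxminTrees (Finset.Icc 1 V.card)).card := by
  have h1 := two_mul_card_lower V
  have h2 := two_mul_card_lower (Finset.Icc 1 V.card)
  rw [card_lowerMarkedTrees] at h1 h2
  simp only [Nat.card_Icc, Nat.add_sub_cancel] at h2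
  exact Nat.eq_of_mul_eq_mul_left hV.card_pos (h1.symm.trans h2)

lemma topCount_one : topCount 1 = 1 := topTrees_singleton 1

lemma lowerMarkedCount_one : lowerMarkedCount 1 = 1 := lowerMarkedTrees_singleton 1

lemma topCount_eq {n : ℕ} (hn : 2 ≤ n) : topCount n = (maxminTrees (Finset.Icc 1 n)).card := by
  rw [topCount, topTrees_eq_maxminTrees (by simp; omega)
    (fun x hx => (Finset.mem_Icc.mp hx).2) (by simpa using hn)]

lemma card_topTrees {V : Finset ℕ} {M : ℕ} (hM : M ∈ V) (hmax : ∀ x ∈ V, x ≤ M) :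
    (topTrees V M).card = topCount V.card := by
  have hpos : 0 < V.card := Finset.card_pos.mpr ⟨M, hM⟩
  obtain h | h : V.card = 1 ∨ 2 ≤ V.card := by omega
  · obtain ⟨x, rfl⟩ := Finset.card_eq_one.mp h
    obtain rfl := Finset.mem_singleton.mp hM
    rw [topTrees_singleton, Finset.card_singleton, topCount_one]
  · rw [topTrees_eq_maxminTrees hM hmax h, topCount_eq h, card_maxminTrees V ⟨M, hM⟩]

lemma two_mul_lowerMarkedCount (n : ℕ) :
    2 * lowerMarkedCount n = n * (maxminTrees (Finset.Icc 1 n)).card := by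
  have h := two_mul_card_lower (Finset.Icc 1 n)
  rwa [Nat.card_Icc, Nat.add_sub_cancel] at h

lemma topCount_recurrence (n : ℕ) : topCount (n + 2) = ∑ i ∈ Finset.range (n + 1),
    n.choose i * (lowerMarkedCount (i + 1) * topCount (n - i + 1)) := by
  have h1 : 1 ∈ Finset.Icc 1 (n + 2) := by simp
  have hn : n + 2 ∈ Finset.Icc 1 (n + 2) := by simp
  have hmax : ∀ x ∈ Finset.Icc 1 (n + 2), x ≤ n + 2 := fun x hx => (Finset.mem_Icc.mp hx).2
  have hcard : (((Finset.Icc 1 (n + 2)).erase (n + 2)).erase 1).card = n := by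
    rw [Finset.card_erase_of_mem (by simp), Finset.card_erase_of_mem hn]
    simp
  rw [topCount_eq (by omega), card_maxminTrees_eq_sum h1 hn (by omega) hmax]
  have hsum := Finset.sum_powerset_apply_card
    (fun i => lowerMarkedCount (i + 1) * topCount (n - i + 1))
    (x := ((Finset.Icc 1 (n + 2)).erase (n + 2)).erase 1)
  simp only [hcard, smul_eq_mul] at hsum
  rw [← hsum]
  refine Finset.sum_congr rfl fun S hS => ?_
  rw [Finset.mem_powerset] at hS
  have h1S : 1 ∉ S := fun h => by simpa using hS h
  have hnS : n + 2 ∉ S := fun h => by simpa using hS h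
  have hSn : S.card ≤ n := hcard ▸ Finset.card_le_card hS
  have hsub : insert 1 S ⊆ Finset.Icc 1 (n + 2) := Finset.insert_subset h1
    (hS.trans ((Finset.erase_subset _ _).trans (Finset.erase_subset _ _)))
  have hc : (insert 1 S).card = S.card + 1 := Finset.card_insert_of_notMem h1S
  rw [card_lowerMarkedTrees, hc, card_topTrees (Finset.mem_sdiff.mpr ⟨hn, by simp [hnS]⟩)
    (fun x hx => hmax x (Finset.mem_sdiff.mp hx).1), Finset.card_sdiff_of_subset hsub, hc]
  simp only [Nat.card_Icc]
  congr 2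
  omega

/-- For `n ≥ 2`, the number `T_{n,2}` of maxmin trees on `{1,…,n}`
(tiered trees with tiers valued in `{1,2}`) satisfies
`T_{n,2} · n · 2^{n−1} = Σ_{k=1}^{n} (n choose k) k^{n−1}`. -/
theorem maxmin_tree_count_formula (n : ℕ) (hn : 2 ≤ n) :
    Tcount n 2 * (n * 2 ^ (n - 1))
      = ∑ k ∈ Finset.Icc 1 n, n.choose k * k ^ (n - 1) := by
  obtain ⟨n, rfl⟩ : ∃ k, n = k + 2 := ⟨n - 2, by omega⟩
  have key := lagrange_of_recurrence (p := fun n => (lowerMarkedCount n : ℚ))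
    (b := fun n => (topCount n : ℚ)) (by simp [topCount_one]) ?_ ?_ (n + 1)
  · have h2 := two_mul_lowerMarkedCount (n + 2)
    have key' : 2 ^ (n + 2) * lowerMarkedCount (n + 2) =
        ∑ k ∈ Finset.range (n + 3), (n + 2).choose k * k ^ (n + 1) := by
      exact_mod_cast key
    have hsum : ∑ k ∈ Finset.Icc 1 (n + 2), (n + 2).choose k * k ^ (n + 1) =
        ∑ k ∈ Finset.range (n + 3), (n + 2).choose k * k ^ (n + 1) := by
      refine Finset.sum_subset (fun x hx => by simp at hx ⊢; omega) fun x hx hx' => ?_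
      obtain rfl : x = 0 := by simp at hx hx'; omega
      simp
    rw [Tcount_two, show n + 2 - 1 = n + 1 by omega, hsum, ← key']
    calc _ = 2 ^ (n + 1) * ((n + 2) * (maxminTrees (Finset.Icc 1 (n + 2))).card) := by ring
      _ = 2 ^ (n + 1) * (2 * lowerMarkedCount (n + 2)) := by rw [h2]
      _ = _ := by ring
  · intro k
    have h2 := two_mul_lowerMarkedCount (k + 1)
    rcases k with _ | k
    · norm_num [lowerMarkedCount_one, topCount_one]
    · rw [topCount_eq (by omega), if_neg (by omega), zero_add]
      exact_mod_cast h2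
  · intro k
    exact_mod_cast topCount_recurrence k
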